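/- Fix an integer r ≥ 1 and real numbers ϑ_1 > ϑ_2 > … > ϑ_r > 0. There exists a constant C > 0, depending only on r and ϑ_1,…,ϑ_r, such that for every integer p ≥ 1, every real Hilbert space H, every orthonormal family q̃_1,…,q̃_r in H, every bounded self-adjoint operator E on H, and every j ∈ {1,…,r}, the following holds: if ξ ∈ H is a unit vector with Tξ = τξ, where T = Σ_{i=1}^r pϑ_i ⟨q̃_i, ·⟩ q̃_i + E and τ ∈ ℝ satisfies |τ − pϑ_j| ≤ ‖E‖_op, and if ⟨ξ, q̃_j⟩ ≥ 0, then ‖ξ − q̃_j‖ ≤ C p^{-1} ‖E‖_op. -/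

import Mathlib

open scoped RealInnerProductSpace

/-- A unit vector making a nonnegative angle cosine with the unit vector `q` is at distance from `q`
at most twice its distance from its projection onto the line spanned by `q`. -/
theorem norm_sub_le_two_mul_norm_sub_inner_smul {H : Type*} [NormedAddCommGroup H]
    [InnerProductSpace ℝ H] {ξ q : H} (hξ : ‖ξ‖ = 1) (hq : ‖q‖ = 1) (h : 0 ≤ ⟪q, ξ⟫) :
    ‖ξ - q‖ ≤ 2 * ‖ξ - ⟪q, ξ⟫ • q‖ := by
  have h_le : ⟪q, ξ⟫ ≤ 1 := by
    simpa [hξ, hq] using real_inner_le_norm q ξ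
  have h_one : 1 - ⟪q, ξ⟫ ≤ ‖ξ - ⟪q, ξ⟫ • q‖ := by
    simpa [hξ, hq, norm_smul, abs_of_nonneg h] using norm_sub_norm_le ξ (⟪q, ξ⟫ • q)
  have h_tri : ‖ξ - q‖ ≤ ‖ξ - ⟪q, ξ⟫ • q‖ + ‖⟪q, ξ⟫ • q - q‖ :=
    norm_sub_le_norm_sub_add_norm_sub _ _ _
  have h_line : ‖⟪q, ξ⟫ • q - q‖ = 1 - ⟪q, ξ⟫ := by
    rw [show ⟪q, ξ⟫ • q - q = (⟪q, ξ⟫ - 1) • q by rw [sub_smul, one_smul], norm_smul, hq, mul_one,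
      Real.norm_eq_abs, abs_sub_comm, abs_of_nonneg (sub_nonneg.2 h_le)]
  linarith

/-- If `ξ` is nearly an eigenvector of `∑ i, c i ⟪q i, ·⟫ q i` for the eigenvalue `c j`, with
residual `g`, then `ξ` is close to the line spanned by `q j`. -/
theorem Orthonormal.mul_norm_sub_inner_smul_le {ι H : Type*} [Fintype ι]
    [NormedAddCommGroup H] [InnerProductSpace ℝ H] {q : ι → H} (hq : Orthonormal ℝ q)
    {c : ι → ℝ} (hc : Function.Injective c) (hpos : ∀ i, 0 < c i) (j : ι) {ξ g : H}
    (hg : ∑ i, (c i * ⟪q i, ξ⟫) • q i - c j • ξ = g) :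
    c j * ‖ξ - ⟪q j, ξ⟫ • q j‖ ≤ (∑ i, c i / |c i - c j| + 1) * ‖g‖ := by
  classical
  have h_coeff (i : ι) : (c i - c j) * ⟪q i, ξ⟫ = ⟪q i, g⟫ := by
    rw [← hg, inner_sub_right, hq.inner_right_fintype, inner_smul_right]
    ring
  have h_split : c j • (ξ - ⟪q j, ξ⟫ • q j) =
      ∑ i ∈ Finset.univ.erase j, (c i * ⟪q i, ξ⟫) • q i - g := by
    rw [← hg, ← Finset.add_sum_erase _ _ (Finset.mem_univ j)]
    module
  have h_term (i : ι) (hi : i ≠ j) :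
      ‖(c i * ⟪q i, ξ⟫) • q i‖ ≤ c i / |c i - c j| * ‖g‖ := by
    have h_gap : 0 < |c i - c j| := abs_pos.2 (sub_ne_zero.2 (hc.ne hi))
    have h_inner : |c i - c j| * |⟪q i, ξ⟫| ≤ ‖g‖ := by
      rw [← abs_mul, h_coeff]
      simpa [hq.1 i] using abs_real_inner_le_norm (q i) g
    rw [norm_smul, hq.1 i, mul_one, Real.norm_eq_abs, abs_mul, abs_of_pos (hpos i),
      div_mul_eq_mul_div, mul_div_assoc]
    exact mul_le_mul_of_nonneg_left ((le_div_iff₀' h_gap).2 h_inner) (hpos i).le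
  calc c j * ‖ξ - ⟪q j, ξ⟫ • q j‖ = ‖c j • (ξ - ⟪q j, ξ⟫ • q j)‖ := by
        rw [norm_smul, Real.norm_eq_abs, abs_of_pos (hpos j)]
    _ ≤ ∑ i ∈ Finset.univ.erase j, c i / |c i - c j| * ‖g‖ + ‖g‖ := by
        rw [h_split]
        refine (norm_sub_le _ _).trans (add_le_add ?_ le_rfl)
        exact norm_sum_le_of_le _ fun i hi => h_term i (Finset.ne_of_mem_erase hi)
    _ ≤ ∑ i, c i / |c i - c j| * ‖g‖ + ‖g‖ := by
        refine add_le_add (Finset.sum_le_univ_sum_of_nonneg fun i => ?_) le_rfl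
        exact mul_nonneg (div_nonneg (hpos i).le (abs_nonneg _)) (norm_nonneg _)
    _ = (∑ i, c i / |c i - c j| + 1) * ‖g‖ := by
        rw [add_mul, Finset.sum_mul, one_mul]

/-- **Proposition 2(ii)** (FPOET asymptotic identifiability, eigenvector part),
stated uniformly in the dimension parameter `p`.  There is a constant `C > 0`, depending
only on `r` and `ϑ_1 > ⋯ > ϑ_r > 0`, such that for every `p ≥ 1`, every real Hilbert
space `H`, every orthonormal family `q̃_1, …, q̃_r` in `H` and every bounded self-adjoint
`E`, any unit eigenvector `ξ` of `T = Σ_i pϑ_i ⟨q̃_i, ·⟩ q̃_i + E` whose eigenvalue `τ`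
satisfies `|τ − pϑ_j| ≤ ‖E‖`, and with `⟨ξ, q̃_j⟩ ≥ 0`, satisfies
`‖ξ − q̃_j‖ ≤ C p⁻¹ ‖E‖`. -/
theorem statement_3.{u} (r : ℕ) (hr : 1 ≤ r) (ϑ : Fin r → ℝ)
    (hanti : StrictAnti ϑ) (hpos : ∀ j, 0 < ϑ j) :
    ∃ C : ℝ, 0 < C ∧
      ∀ (p : ℕ), 1 ≤ p →
      ∀ (H : Type u) [NormedAddCommGroup H] [InnerProductSpace ℝ H] [CompleteSpace H]
        (q : Fin r → H), Orthonormal ℝ q →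
      ∀ (E : H →L[ℝ] H), IsSelfAdjoint E →
      ∀ (T : H →L[ℝ] H),
        T = (∑ i : Fin r, ((p : ℝ) * ϑ i) • ((innerSL ℝ (q i)).smulRight (q i))) + E →
      ∀ (j : Fin r) (ξ : H) (τ : ℝ), ‖ξ‖ = 1 → T ξ = τ • ξ →
        |τ - (p : ℝ) * ϑ j| ≤ ‖E‖ → 0 ≤ ⟪ξ, q j⟫ →
        ‖ξ - q j‖ ≤ C * ‖E‖ / (p : ℝ) := by
  have h_const (j : Fin r) : 0 < 4 * (∑ i, ϑ i / |ϑ i - ϑ j| + 1) / ϑ j := by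
    have h_sum : 0 ≤ ∑ i, ϑ i / |ϑ i - ϑ j| :=
      Finset.sum_nonneg fun i _ => div_nonneg (hpos i).le (abs_nonneg _)
    have := hpos j
    positivity
  refine ⟨∑ j, 4 * (∑ i, ϑ i / |ϑ i - ϑ j| + 1) / ϑ j,
    Finset.sum_pos (fun j _ => h_const j) ⟨⟨0, hr⟩, Finset.mem_univ _⟩, ?_⟩
  intro p hp H _ _ _ q hq E _ T hT j ξ τ hξ hTξ hτ hinner
  have hp_pos : (0 : ℝ) < p := by exact_mod_cast hp
  have h_resid : ∑ i, ((p * ϑ i) * ⟪q i, ξ⟫) • q i - (p * ϑ j) • ξ = (τ - p * ϑ j) • ξ - E ξ := by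
    have h_apply : ∑ i, ((p * ϑ i) * ⟪q i, ξ⟫) • q i + E ξ = τ • ξ := by
      rw [← hTξ, hT]
      simp [mul_smul]
    rw [sub_smul, ← h_apply]
    abel
  have h_resid_norm : ‖(τ - p * ϑ j) • ξ - E ξ‖ ≤ 2 * ‖E‖ := by
    have h_tri := norm_sub_le ((τ - p * ϑ j) • ξ) (E ξ)
    have h_op := E.le_opNorm ξ
    rw [norm_smul, hξ, mul_one, Real.norm_eq_abs] at h_tri
    rw [hξ, mul_one] at h_op
    linarith
  have h_main := hq.mul_norm_sub_inner_smul_le (c := fun i => p * ϑ i)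
    (fun a b hab => hanti.injective (mul_left_cancel₀ hp_pos.ne' hab))
    (fun i => mul_pos hp_pos (hpos i)) j h_resid
  have h_scale (i : Fin r) : p * ϑ i / |p * ϑ i - p * ϑ j| = ϑ i / |ϑ i - ϑ j| := by
    rw [← mul_sub, abs_mul, abs_of_pos hp_pos, mul_div_mul_left _ _ hp_pos.ne']
  simp only [h_scale] at h_main
  have h_factor : 0 ≤ ∑ i, ϑ i / |ϑ i - ϑ j| + 1 :=
    add_nonneg (Finset.sum_nonneg fun i _ => div_nonneg (hpos i).le (abs_nonneg _)) zero_le_one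
  have h_proj : ‖ξ - ⟪q j, ξ⟫ • q j‖ ≤
      (∑ i, ϑ i / |ϑ i - ϑ j| + 1) * (2 * ‖E‖) / (p * ϑ j) :=
    (le_div_iff₀' (mul_pos hp_pos (hpos j))).2
      (h_main.trans (mul_le_mul_of_nonneg_left h_resid_norm h_factor))
  rw [real_inner_comm] at hinner
  calc ‖ξ - q j‖ ≤ 2 * ‖ξ - ⟪q j, ξ⟫ • q j‖ :=
        norm_sub_le_two_mul_norm_sub_inner_smul hξ (hq.1 j) hinner
    _ ≤ 2 * ((∑ i, ϑ i / |ϑ i - ϑ j| + 1) * (2 * ‖E‖) / (p * ϑ j)) := by gcongr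
    _ = 4 * (∑ i, ϑ i / |ϑ i - ϑ j| + 1) / ϑ j * ‖E‖ / p := by
        have := (hpos j).ne'
        field_simp
        ring
    _ ≤ (∑ j, 4 * (∑ i, ϑ i / |ϑ i - ϑ j| + 1) / ϑ j) * ‖E‖ / p := by
        gcongr
        exact Finset.single_le_sum (f := fun j => 4 * (∑ i, ϑ i / |ϑ i - ϑ j| + 1) / ϑ j)
          (fun k _ => (h_const k).le) (Finset.mem_univ j)
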